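/- arXiv:2106.15034 — 3 statements merged into one kernel-verified Lean document; each statement's English description precedes it below -/
import Mathlib

section
/- Let (V, dist) be a finite metric space with a depot r \in V, a demand function d : V \to \mathbb{N} with positive total demand, and a capacity Q \ge 1. Then a minimum-cost feasible solution exists, and moreover there exists a minimum-cost feasible solution in which at most one tour picks up at most Q/2 tokens: if a feasible solution contains two tours each picking up fewer than Q/2 tokens, then concatenating the two closed walks at r and combining their token assignments yields a feasible solution with one fewer tour, no greater cost, and the merged tour picking up at most Q tokens. -/
open Finset

/-- A CVRP tour in a finite metric space `V` with depot `r` and capacity `Q`: a closed walk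
starting and ending at `r` together with an assignment of the number of tokens picked up at
each vertex it visits, totalling at most `Q`. -/
structure CVRPTour (V : Type*) [Fintype V] (r : V) (Q : ℕ) where
  walk : List V
  pickup : V → ℕ
  walk_ne : walk ≠ []
  head_eq : walk.head walk_ne = r
  last_eq : walk.getLast walk_ne = r
  pickup_mem : ∀ v, pickup v ≠ 0 → v ∈ walk
  cap : ∑ v, pickup v ≤ Q

/-- The cost of a tour: the sum of the distances over consecutive pairs of its walk. -/
noncomputable def tourCost {V : Type*} [Fintype V] [MetricSpace V] {r : V} {Q : ℕ}
    (t : CVRPTour V r Q) : ℝ :=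
  ((t.walk.zip t.walk.tail).map (fun q => dist q.1 q.2)).sum

/-- A solution (finite multiset of tours) is feasible if for every vertex `v` the tokens
picked up at `v` over all tours sum to exactly the demand `d v`. -/
def CVRPFeasible {V : Type*} [Fintype V] {r : V} {Q : ℕ} (d : V → ℕ)
    (S : Multiset (CVRPTour V r Q)) : Prop :=
  ∀ v, (S.map (fun t => t.pickup v)).sum = d v

/-- The cost of a solution: the sum of the costs of its tours. -/
noncomputable def solCost {V : Type*} [Fintype V] [MetricSpace V] {r : V} {Q : ℕ}
    (S : Multiset (CVRPTour V r Q)) : ℝ :=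
  (S.map (fun t => tourCost t)).sum

/-- The sum of the distances over consecutive pairs of a list of points. -/
noncomputable def walkLength {V : Type*} [MetricSpace V] (l : List V) : ℝ :=
  ((l.zip l.tail).map (fun q => dist q.1 q.2)).sum

theorem walkLength_append_cons {V : Type*} [MetricSpace V] (a b : List V) (r : V) :
    walkLength (a ++ r :: b) = walkLength (a ++ [r]) + walkLength (r :: b) := by
  induction a with
  | nil => simp [walkLength]
  | cons x a ih =>
    cases a with
    | nil => simp [walkLength]
    | cons y a =>
      simp only [walkLength, List.cons_append, List.tail_cons, List.zip_cons_cons,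
        List.map_cons, List.sum_cons] at ih ⊢
      rw [ih, add_assoc]

namespace CVRPTour

variable {V : Type*} [Fintype V] {r : V} {Q : ℕ}

theorem exists_walk_eq_append (t : CVRPTour V r Q) : ∃ a, t.walk = a ++ [r] :=
  ⟨t.walk.dropLast, by
    conv_lhs => rw [← List.dropLast_append_getLast t.walk_ne, t.last_eq]⟩

theorem walk_eq_cons (t : CVRPTour V r Q) : t.walk = r :: t.walk.tail := by
  conv_lhs => rw [← List.cons_head_tail t.walk_ne, t.head_eq]

/-- The concatenation of two tours at the depot. -/
def merge (t₁ t₂ : CVRPTour V r Q)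
    (h : ∑ v, t₁.pickup v + ∑ v, t₂.pickup v ≤ Q) : CVRPTour V r Q where
  walk := t₁.walk ++ t₂.walk.tail
  pickup v := t₁.pickup v + t₂.pickup v
  walk_ne := by simp [t₁.walk_ne]
  head_eq := by rw [List.head_append_of_ne_nil t₁.walk_ne, t₁.head_eq]
  last_eq := by
    obtain ⟨a, ha⟩ := t₁.exists_walk_eq_append
    have hw : t₁.walk ++ t₂.walk.tail = a ++ t₂.walk := by
      rw [ha, List.append_assoc, List.singleton_append, ← t₂.walk_eq_cons]
    simp only [hw]
    rw [List.getLast_append_of_ne_nil _ t₂.walk_ne, t₂.last_eq]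
  pickup_mem v hv := by
    by_cases h₁ : t₁.pickup v = 0
    · have h₂ : v ∈ t₂.walk := t₂.pickup_mem v (by omega)
      rw [t₂.walk_eq_cons, List.mem_cons] at h₂
      rcases h₂ with rfl | h₂
      · obtain ⟨a, ha⟩ := t₁.exists_walk_eq_append
        simp [ha]
      · exact List.mem_append_right _ h₂
    · exact List.mem_append_left _ (t₁.pickup_mem v h₁)
  cap := by rwa [Finset.sum_add_distrib]

/-- The tour that visits `v` and picks up a single token there. -/
def singleToken [DecidableEq V] (r : V) (hQ : 1 ≤ Q) (v : V) : CVRPTour V r Q where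
  walk := [r, v, r]
  pickup := Pi.single v 1
  walk_ne := by simp
  head_eq := rfl
  last_eq := rfl
  pickup_mem u hu := by
    have : u = v := by
      by_contra hne
      exact hu (Pi.single_eq_of_ne hne 1)
    simp [this]
  cap := by simpa using hQ

end CVRPTour

section Solutions

variable {V : Type*} [Fintype V] {r : V} {Q : ℕ}

theorem tourCost_merge [MetricSpace V] (t₁ t₂ : CVRPTour V r Q)
    (h : ∑ v, t₁.pickup v + ∑ v, t₂.pickup v ≤ Q) :
    tourCost (t₁.merge t₂ h) = tourCost t₁ + tourCost t₂ := by
  change walkLength (t₁.walk ++ t₂.walk.tail) = walkLength t₁.walk + walkLength t₂.walk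
  obtain ⟨a, ha⟩ := t₁.exists_walk_eq_append
  rw [ha, t₂.walk_eq_cons, List.tail_cons, List.append_assoc, List.singleton_append,
    walkLength_append_cons]

theorem solCost_merge [MetricSpace V] (t₁ t₂ : CVRPTour V r Q)
    (h : ∑ v, t₁.pickup v + ∑ v, t₂.pickup v ≤ Q) (rest : Multiset (CVRPTour V r Q)) :
    solCost (t₁.merge t₂ h ::ₘ rest) = solCost (t₁ ::ₘ t₂ ::ₘ rest) := by
  simp [solCost, tourCost_merge, add_assoc]

theorem CVRPFeasible.merge {d : V → ℕ} {t₁ t₂ : CVRPTour V r Q}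
    {rest : Multiset (CVRPTour V r Q)} (hS : CVRPFeasible d (t₁ ::ₘ t₂ ::ₘ rest))
    (h : ∑ v, t₁.pickup v + ∑ v, t₂.pickup v ≤ Q) :
    CVRPFeasible d (t₁.merge t₂ h ::ₘ rest) := by
  intro v
  have := hS v
  simp only [Multiset.map_cons, Multiset.sum_cons] at this ⊢
  rw [← this, ← add_assoc]
  rfl

theorem exists_cvrpFeasible (r : V) (hQ : 1 ≤ Q) (d : V → ℕ) :
    ∃ S : Multiset (CVRPTour V r Q), CVRPFeasible d S := by
  classical
  refine ⟨∑ v, Multiset.replicate (d v) (CVRPTour.singleToken r hQ v), fun u => ?_⟩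
  rw [← Multiset.coe_mapAddMonoidHom, map_sum, ← Multiset.coe_sumAddMonoidHom, map_sum]
  simp [CVRPTour.singleToken, Pi.single_apply]

theorem solCost_mem_closure [MetricSpace V] (S : Multiset (CVRPTour V r Q)) :
    solCost S ∈ AddSubmonoid.closure (Set.range fun q : V × V => dist q.1 q.2) := by
  refine AddSubmonoid.multiset_sum_mem _ _ fun x hx => ?_
  obtain ⟨t, -, rfl⟩ := Multiset.mem_map.1 hx
  refine AddSubmonoid.list_sum_mem _ fun y hy => ?_
  obtain ⟨q, -, rfl⟩ := List.mem_map.1 hy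
  exact AddSubmonoid.subset_closure ⟨q, rfl⟩

/-- The costs of solutions are sums of elements of the finite set of distances, so they are
well-founded. -/
theorem isWF_range_solCost [MetricSpace V] (r : V) (Q : ℕ) :
    (Set.range (solCost : Multiset (CVRPTour V r Q) → ℝ)).IsWF := by
  have hpwo : (AddSubmonoid.closure
      (Set.range fun q : V × V => dist q.1 q.2) : Set ℝ).IsPWO :=
    Set.IsPWO.addSubmonoid_closure (by rintro _ ⟨q, rfl⟩; exact dist_nonneg)
      (Set.finite_range _).isPWO
  refine (hpwo.mono ?_).isWF
  rintro _ ⟨S, rfl⟩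
  exact solCost_mem_closure S

/-- Among the feasible solutions of minimum cost there is one with the fewest tours. -/
theorem exists_min_solCost_min_card [MetricSpace V] (r : V) (hQ : 1 ≤ Q) (d : V → ℕ) :
    ∃ S : Multiset (CVRPTour V r Q), CVRPFeasible d S ∧
      (∀ S' : Multiset (CVRPTour V r Q), CVRPFeasible d S' → solCost S ≤ solCost S') ∧
      ∀ S' : Multiset (CVRPTour V r Q), CVRPFeasible d S' → solCost S' ≤ solCost S →
        S.card ≤ S'.card := by
  obtain ⟨S₀, hS₀⟩ := exists_cvrpFeasible r hQ d
  have hwf : (solCost '' {S : Multiset (CVRPTour V r Q) | CVRPFeasible d S}).IsWF :=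
    (isWF_range_solCost r Q).mono (Set.image_subset_range _ _)
  have hne : (solCost '' {S : Multiset (CVRPTour V r Q) | CVRPFeasible d S}).Nonempty :=
    ⟨_, S₀, hS₀, rfl⟩
  obtain ⟨S₁, hS₁, hmin⟩ := hwf.min_mem hne
  have hle : ∀ S' : Multiset (CVRPTour V r Q), CVRPFeasible d S' →
      solCost S₁ ≤ solCost S' := fun S' hS' =>
    hmin.trans_le (hwf.min_le hne ⟨S', hS', rfl⟩)
  obtain ⟨S, ⟨hS, hcost⟩, hcard⟩ := exists_minimalFor_of_wellFoundedLT
    (fun S : Multiset (CVRPTour V r Q) => CVRPFeasible d S ∧ solCost S ≤ solCost S₁)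
    Multiset.card ⟨S₁, hS₁, le_rfl⟩
  refine ⟨S, hS, fun S' hS' => hcost.trans (hle S' hS'), fun S' hS' h => ?_⟩
  rcases le_total S.card S'.card with h' | h'
  · exact h'
  · exact hcard ⟨hS', h.trans hcost⟩ h'

theorem sum_pickup_add_le (t₁ t₂ : CVRPTour V r Q)
    (h₁ : (∑ v, t₁.pickup v : ℝ) ≤ Q / 2) (h₂ : (∑ v, t₂.pickup v : ℝ) ≤ Q / 2) :
    ∑ v, t₁.pickup v + ∑ v, t₂.pickup v ≤ Q := by
  have : (∑ v, t₁.pickup v : ℝ) + ∑ v, (t₂.pickup v : ℝ) ≤ Q := by linarith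
  exact_mod_cast this

end Solutions

/-- In CVRP on a finite metric space with positive total demand: a minimum-cost feasible
solution exists; there is a minimum-cost feasible solution in which at most one tour picks up
at most `Q/2` tokens; and whenever a feasible solution contains two tours each picking up
fewer than `Q/2` tokens, concatenating their walks at the depot and combining their token
assignments gives a feasible solution with one fewer tour, no greater cost, the merged tour
picking up at most `Q` tokens. -/
theorem stmt_6 {V : Type*} [Fintype V] [MetricSpace V] (r : V)
    (d : V → ℕ) (hd : 0 < ∑ v, d v) (Q : ℕ) (hQ : 1 ≤ Q) :
    (∃ S : Multiset (CVRPTour V r Q), CVRPFeasible d S ∧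
        ∀ S' : Multiset (CVRPTour V r Q), CVRPFeasible d S' → solCost S ≤ solCost S') ∧
    (∃ S : Multiset (CVRPTour V r Q), CVRPFeasible d S ∧
        (∀ S' : Multiset (CVRPTour V r Q), CVRPFeasible d S' → solCost S ≤ solCost S') ∧
        ∀ (t₁ t₂ : CVRPTour V r Q) (rest : Multiset (CVRPTour V r Q)),
          S = t₁ ::ₘ t₂ ::ₘ rest →
          ¬((∑ v, t₁.pickup v : ℝ) ≤ Q / 2 ∧ (∑ v, t₂.pickup v : ℝ) ≤ Q / 2)) ∧
    (∀ (S : Multiset (CVRPTour V r Q)) (t₁ t₂ : CVRPTour V r Q)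
        (rest : Multiset (CVRPTour V r Q)),
        CVRPFeasible d S → S = t₁ ::ₘ t₂ ::ₘ rest →
        (∑ v, t₁.pickup v : ℝ) < Q / 2 → (∑ v, t₂.pickup v : ℝ) < Q / 2 →
        ∃ t : CVRPTour V r Q,
          t.walk = t₁.walk ++ t₂.walk.tail ∧
          (∀ v, t.pickup v = t₁.pickup v + t₂.pickup v) ∧
          CVRPFeasible d (t ::ₘ rest) ∧
          (t ::ₘ rest).card + 1 = S.card ∧
          solCost (t ::ₘ rest) ≤ solCost S ∧
          (∑ v, t.pickup v : ℝ) ≤ Q) := by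
  obtain ⟨S, hS, hmin, hcard⟩ := exists_min_solCost_min_card r hQ d
  refine ⟨⟨S, hS, hmin⟩, ⟨S, hS, hmin, ?_⟩, ?_⟩
  · rintro t₁ t₂ rest rfl ⟨h₁, h₂⟩
    have h := sum_pickup_add_le t₁ t₂ h₁ h₂
    have := hcard _ (hS.merge h) (solCost_merge t₁ t₂ h rest).le
    simp at this
  · rintro S t₁ t₂ rest hS rfl h₁ h₂
    have h := sum_pickup_add_le t₁ t₂ h₁.le h₂.le
    refine ⟨t₁.merge t₂ h, rfl, fun _ => rfl, hS.merge h, by simp,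
      (solCost_merge t₁ t₂ h rest).le, ?_⟩
    exact_mod_cast (t₁.merge t₂ h).cap
end

section
/- Let T be a finite rooted tree with n \ge 2 vertices. Then the edge set of T can be partitioned into edge-disjoint vertical paths (each path descending from a vertex to one of its descendants), and each path of the partition can be assigned a level in \{1, 2, ..., \lceil \log_2 n \rceil\}, such that for every root-to-leaf path P of T, P is the concatenation of subpaths each of which is contained in a single path of the partition, P uses at most one subpath from each level, and the levels of the partition paths traversed by P are strictly increasing from the root towards the leaf. -/
/-- `u` is a descendant of `v` (possibly `v` itself) for the parent function `parent`. -/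
def IsDescendant {V : Type*} (parent : V → V) (u v : V) : Prop :=
  ∃ m : ℕ, parent^[m] u = v

open Classical in
/-- The number of descendants of `v`, including `v`. -/
noncomputable def subtreeSize {V : Type*} [Fintype V] (parent : V → V) (v : V) : ℕ :=
  (Finset.univ.filter fun w => IsDescendant parent w v).card

namespace IsDescendant

variable {V : Type*} {parent : V → V} {u v w : V}

theorem refl (u : V) : IsDescendant parent u u := ⟨0, rfl⟩

theorem trans (h : IsDescendant parent u v) (h' : IsDescendant parent v w) :
    IsDescendant parent u w := by
  obtain ⟨m, rfl⟩ := h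
  obtain ⟨k, rfl⟩ := h'
  exact ⟨k + m, Function.iterate_add_apply ..⟩

theorem iterate_of_le (u : V) {j m : ℕ} (h : j ≤ m) :
    IsDescendant parent (parent^[j] u) (parent^[m] u) :=
  ⟨m - j, by rw [← Function.iterate_add_apply, Nat.sub_add_cancel h]⟩

/-- Two ancestors of the same vertex are comparable. -/
theorem comparable (h : IsDescendant parent u v) (h' : IsDescendant parent u w) :
    IsDescendant parent v w ∨ IsDescendant parent w v := by
  obtain ⟨m, rfl⟩ := h
  obtain ⟨k, rfl⟩ := h'
  exact (le_total m k).imp (iterate_of_le u) (iterate_of_le u)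

variable [Fintype V]

theorem subtreeSize_le (h : IsDescendant parent u v) :
    subtreeSize parent u ≤ subtreeSize parent v :=
  Finset.card_le_card fun _ hw => by
    simp only [Finset.mem_filter_univ] at hw ⊢
    exact hw.trans h

end IsDescendant

section subtreeSize

variable {V : Type*} [Fintype V] {parent : V → V}

theorem subtreeSize_ne_zero (u : V) : subtreeSize parent u ≠ 0 :=
  Finset.card_ne_zero_of_mem (a := u) (by simpa using IsDescendant.refl u)

theorem subtreeSize_lt_card {r u : V} (hroot : parent r = r) (hu : u ≠ r) :
    subtreeSize parent u < Fintype.card V := by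
  refine Finset.card_lt_univ_of_notMem (x := r) ?_
  simp only [Finset.mem_filter_univ]
  rintro ⟨m, hm⟩
  exact hu (by rw [← hm, Function.iterate_fixed hroot])

/-- Incomparable vertices have disjoint subtrees. -/
theorem subtreeSize_add_le {u v w : V} (hu : IsDescendant parent u w)
    (hv : IsDescendant parent v w)
    (h : ¬(IsDescendant parent u v ∨ IsDescendant parent v u)) :
    subtreeSize parent u + subtreeSize parent v ≤ subtreeSize parent w := by
  classical
  unfold subtreeSize
  rw [← Finset.card_union_of_disjoint]
  · refine Finset.card_le_card fun x hx => ?_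
    simp only [Finset.mem_union, Finset.mem_filter_univ] at hx ⊢
    exact hx.elim (·.trans hu) (·.trans hv)
  · refine Finset.disjoint_left.2 fun x hx hx' => ?_
    simp only [Finset.mem_filter_univ] at hx hx'
    exact h (hx.comparable hx')

/-- Two descendants of `w` whose subtrees have the same binary order of magnitude as that of `w`
are comparable. -/
theorem comparable_of_log_subtreeSize_eq {u v w : V} (hu : IsDescendant parent u w)
    (hv : IsDescendant parent v w)
    (hlu : Nat.log 2 (subtreeSize parent u) = Nat.log 2 (subtreeSize parent w))
    (hlv : Nat.log 2 (subtreeSize parent v) = Nat.log 2 (subtreeSize parent w)) :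
    IsDescendant parent u v ∨ IsDescendant parent v u := by
  by_contra h
  have hsum := subtreeSize_add_le hu hv h
  have hpu := Nat.pow_log_le_self 2 (subtreeSize_ne_zero (parent := parent) u)
  have hpv := Nat.pow_log_le_self 2 (subtreeSize_ne_zero (parent := parent) v)
  have hw := Nat.lt_pow_succ_log_self one_lt_two (subtreeSize parent w)
  rw [hlu] at hpu
  rw [hlv] at hpv
  rw [pow_succ] at hw
  omega

/-- Vertices are equivalent when they are comparable and their subtrees have the same binary order
of magnitude; the classes are vertical paths. -/
def heavyPathSetoid (parent : V → V) : Setoid V where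
  r u v := Nat.log 2 (subtreeSize parent u) = Nat.log 2 (subtreeSize parent v) ∧
    (IsDescendant parent u v ∨ IsDescendant parent v u)
  iseqv :=
    { refl := fun u => ⟨rfl, .inl (.refl u)⟩
      symm := fun h => ⟨h.1.symm, h.2.symm⟩
      trans := by
        rintro u v w ⟨huv, hc⟩ ⟨hvw, hc'⟩
        refine ⟨huv.trans hvw, ?_⟩
        rcases hc with hc | hc <;> rcases hc' with hc' | hc'
        · exact .inl (hc.trans hc')
        · exact comparable_of_log_subtreeSize_eq hc hc' huv hvw.symm
        · exact hc.comparable hc'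
        · exact .inr (hc'.trans hc) }

end subtreeSize


/-- Path decomposition with levels.  The tree `T` is a finite rooted tree given by its parent
function with root `r`; its edges are identified with the non-root vertices (`u ↔` the edge
`u – parent u`).  The edge set can be partitioned into edge-disjoint vertical paths (the
classes of `pid`), each assigned a level `lvl` in `{1, …, ⌈log₂ n⌉}`, such that:
* edges with the same `pid` have the same level and are pairwise ancestor-comparable, and the
  edges of a `pid`-class between two of its members all belong to the class (so each class is
  a vertical path descending from a vertex to one of its descendants);
* along any root-to-leaf path, consecutive edges either belong to the same partition path or
  their levels strictly increase towards the leaf — hence every root-to-leaf path is a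
  concatenation of subpaths each contained in a single partition path, using at most one
  subpath from each level, with levels strictly increasing from the root towards the leaf. -/
theorem stmt_11 {V : Type*} [Fintype V] (parent : V → V) (r : V)
    (hroot : parent r = r)
    (hreach : ∀ u, ∃ m : ℕ, parent^[m] u = r)
    (hn : 2 ≤ Fintype.card V) :
    ∃ pid lvl : V → ℕ,
      (∀ u, u ≠ r → 1 ≤ lvl u ∧ lvl u ≤ Nat.clog 2 (Fintype.card V)) ∧
      (∀ u u', u ≠ r → u' ≠ r → pid u = pid u' → lvl u = lvl u') ∧
      (∀ u u', u ≠ r → u' ≠ r → pid u = pid u' →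
        (∃ m : ℕ, parent^[m] u = u') ∨ (∃ m : ℕ, parent^[m] u' = u)) ∧
      (∀ u (m : ℕ), u ≠ r → parent^[m] u ≠ r → pid u = pid (parent^[m] u) →
        ∀ j ≤ m, pid (parent^[j] u) = pid u) ∧
      (∀ u, u ≠ r → parent u ≠ r →
        pid u = pid (parent u) ∨ lvl (parent u) < lvl u) := by
  classical
  let ℓ : V → ℕ := fun u => Nat.log 2 (subtreeSize parent u)
  let pid : V → ℕ := fun u => Fintype.equivFin _ (Quotient.mk (heavyPathSetoid parent) u)
  have hpid (u v : V) : pid u = pid v ↔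
      ℓ u = ℓ v ∧ (IsDescendant parent u v ∨ IsDescendant parent v u) := by
    simp only [pid, Fin.val_inj, EmbeddingLike.apply_eq_iff_eq]
    exact Quotient.eq
  have hmono {u v : V} (h : IsDescendant parent u v) : ℓ u ≤ ℓ v :=
    Nat.log_mono_right h.subtreeSize_le
  have hlt (u : V) (hu : u ≠ r) : ℓ u < Nat.clog 2 (Fintype.card V) :=
    (Nat.lt_clog_iff_pow_lt one_lt_two).2 <|
      (Nat.pow_log_le_self 2 (subtreeSize_ne_zero u)).trans_lt (subtreeSize_lt_card hroot hu)
  refine ⟨pid, fun u => Nat.clog 2 (Fintype.card V) - ℓ u, fun u hu => ?_,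
    fun u v _ _ h => ?_, fun u v _ _ h => ((hpid u v).1 h).2, fun u m _ _ h j hj => ?_,
    fun u _ hpu => ?_⟩
  · have := hlt u hu
    dsimp only
    omega
  · simp only [((hpid u v).1 h).1]
  · have hlog := ((hpid _ _).1 h).1
    have huj : IsDescendant parent u (parent^[j] u) := ⟨j, rfl⟩
    have hjm := hmono (IsDescendant.iterate_of_le (parent := parent) u hj)
    exact (hpid _ _).2 ⟨le_antisymm (hjm.trans hlog.ge) (hmono huj), .inr huj⟩
  · have hup : IsDescendant parent u (parent u) := ⟨1, rfl⟩
    rcases (hmono hup).eq_or_lt with h | h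
    · exact .inl ((hpid _ _).2 ⟨h, .inl hup⟩)
    · have := hlt _ hpu
      right
      dsimp only
      omega
end

section
/- There is an absolute constant \delta > 0 such that the following holds. Let 0 < \varepsilon \le 1 and let T be a rooted tree with n \ge 2 vertices, root (depot) r, and positive integer edge weights each at most 4n^3/\varepsilon^2. Then there exists a rooted tree T' on the same vertex set with the same root and nonnegative edge weights, whose height is at most \delta \log^2 n / \varepsilon, such that for every demand function d : V \to \mathbb{N} and every capacity Q \ge 1, the optimal CVRP values satisfy opt(T', d, Q) \le opt(T, d, Q) \le (1+\varepsilon) \, opt(T', d, Q). -/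
open scoped Classical

/-- A finite rooted tree on the vertex type `V`, given by its parent function: the root is a
fixed point of `parent` and every vertex reaches the root by iterating `parent`. -/
structure ParentTree (V : Type*) where
  parent : V → V
  root : V
  root_fix : parent root = root
  reach : ∀ v, ∃ m : ℕ, parent^[m] v = root

namespace ParentTree

variable {V : Type*} [Fintype V]

/-- Tree adjacency: `u` and `v` are joined by a tree edge. -/
def Adj (T : ParentTree V) (u v : V) : Prop :=
  u ≠ v ∧ (T.parent u = v ∨ T.parent v = u)

/-- The cost of traversing the tree edge between adjacent vertices `u` and `v`, where
`w x` is the weight of the edge from `x` to its parent. -/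
noncomputable def stepCost (T : ParentTree V) (w : V → ℝ) (u v : V) : ℝ :=
  if T.parent u = v then w u else w v

/-- The weight of a walk: the sum of the weights of its edges counted with multiplicity. -/
noncomputable def walkCost (T : ParentTree V) (w : V → ℝ) (l : List V) : ℝ :=
  ((l.zip l.tail).map (fun q => T.stepCost w q.1 q.2)).sum

/-- A CVRP tour in the tree `T` with capacity `Q`: a closed walk starting and ending at the
root (depot) together with an assignment of the number of tokens picked up at each vertex it
visits, totalling at most `Q`. -/
structure Tour (T : ParentTree V) (Q : ℕ) where
  walk : List V
  pickup : V → ℕ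
  walk_ne : walk ≠ []
  chain : walk.Chain' T.Adj
  head_eq : walk.head walk_ne = T.root
  last_eq : walk.getLast walk_ne = T.root
  pickup_mem : ∀ v, pickup v ≠ 0 → v ∈ walk
  cap : ∑ v, pickup v ≤ Q

/-- A solution (finite multiset of tours) is feasible for the demand `d` if for every vertex
`v` the tokens picked up at `v` over all tours sum to exactly `d v`. -/
def Feasible (T : ParentTree V) (Q : ℕ) (d : V → ℕ) (S : Multiset (T.Tour Q)) : Prop :=
  ∀ v, (S.map (fun t => t.pickup v)).sum = d v

/-- The cost of a tour. -/
noncomputable def tourCost (T : ParentTree V) (w : V → ℝ) {Q : ℕ} (t : T.Tour Q) : ℝ :=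
  T.walkCost w t.walk

/-- The cost of a solution: the sum of the costs of its tours. -/
noncomputable def solCost (T : ParentTree V) (w : V → ℝ) {Q : ℕ}
    (S : Multiset (T.Tour Q)) : ℝ :=
  (S.map (fun t => T.tourCost w t)).sum

/-- The optimum CVRP value `opt(T, d, Q)`. -/
noncomputable def opt (T : ParentTree V) (w : V → ℝ) (d : V → ℕ) (Q : ℕ) : ℝ :=
  sInf {c : ℝ | ∃ S : Multiset (T.Tour Q), T.Feasible Q d S ∧ T.solCost w S = c}

/-- The height of the rooted tree (the maximum number of edges on a root-to-leaf path) is at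
most `H`. -/
def heightLE (T : ParentTree V) (H : ℝ) : Prop :=
  ∀ v, ∃ m : ℕ, (m : ℝ) ≤ H ∧ T.parent^[m] v = T.root

end ParentTree

namespace ParentTree

variable {V : Type*}

/-- `u` is a (weak) ancestor of `v`. -/
def Anc (T : ParentTree V) (u v : V) : Prop :=
  ∃ m : ℕ, T.parent^[m] v = u

theorem Anc.refl (T : ParentTree V) (v : V) : T.Anc v v := ⟨0, rfl⟩

theorem Anc.of_parent {T : ParentTree V} {u v : V} (h : T.Anc u (T.parent v)) : T.Anc u v := by
  obtain ⟨m, hm⟩ := h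
  exact ⟨m + 1, by simpa [Function.iterate_succ_apply] using hm⟩

theorem Anc.parent_left {T : ParentTree V} {u v : V} (h : T.Anc u v) : T.Anc (T.parent u) v := by
  obtain ⟨m, hm⟩ := h
  exact ⟨m + 1, by rw [Function.iterate_succ_apply', hm]⟩

theorem Anc.parent_of_ne {T : ParentTree V} {u v : V} (h : T.Anc u v) (hne : u ≠ v) :
    T.Anc u (T.parent v) := by
  obtain ⟨m, hm⟩ := h
  cases m with
  | zero => exact absurd hm.symm hne
  | succ m => exact ⟨m, by simpa [Function.iterate_succ_apply] using hm⟩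

theorem Anc.total {T : ParentTree V} {a b u : V} (ha : T.Anc a u) (hb : T.Anc b u) :
    T.Anc a b ∨ T.Anc b a := by
  obtain ⟨m, rfl⟩ := ha
  obtain ⟨k, rfl⟩ := hb
  rcases le_total m k with h | h
  · exact Or.inr ⟨k - m, by rw [← Function.iterate_add_apply]; congr 2; omega⟩
  · exact Or.inl ⟨m - k, by rw [← Function.iterate_add_apply]; congr 2; omega⟩

theorem Anc.eq_root {T : ParentTree V} {u : V} (h : T.Anc u T.root) : u = T.root := by
  obtain ⟨m, hm⟩ := h
  rw [Function.iterate_fixed T.root_fix] at hm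
  exact hm.symm

/-- The number of edges on the path from `v` to the root. -/
noncomputable def depth (T : ParentTree V) (v : V) : ℕ := Nat.find (T.reach v)

theorem depth_parent (T : ParentTree V) {v : V} (hv : v ≠ T.root) :
    T.depth v = T.depth (T.parent v) + 1 := by
  unfold depth
  exact Nat.find_comp_succ (T.reach v) (T.reach (T.parent v)) hv

theorem depth_root (T : ParentTree V) : T.depth T.root = 0 := by
  simp [depth]

theorem iterate_depth (T : ParentTree V) (v : V) : T.parent^[T.depth v] v = T.root :=
  Nat.find_spec (T.reach v)

theorem induction {T : ParentTree V} {P : V → Prop} (root : P T.root)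
    (step : ∀ v, v ≠ T.root → P (T.parent v) → P v) (v : V) : P v := by
  induction h : T.depth v generalizing v with
  | zero =>
    have := T.iterate_depth v
    rw [h] at this
    simp only [Function.iterate_zero, id_eq] at this
    exact this ▸ root
  | succ k ih =>
    by_cases hv : v = T.root
    · exact hv ▸ root
    · exact step v hv (ih _ (by have := T.depth_parent hv; omega))

theorem Anc.depth_le {T : ParentTree V} {u v : V} (h : T.Anc u v) : T.depth u ≤ T.depth v := by
  induction v using induction (T := T) with
  | root => rw [h.eq_root]
  | step v hv ih =>
    by_cases huv : u = v
    · rw [huv]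
    · have := ih (h.parent_of_ne huv)
      have := T.depth_parent hv
      omega

theorem not_anc_parent (T : ParentTree V) {v : V} (hv : v ≠ T.root) : ¬ T.Anc v (T.parent v) := by
  intro h
  have := h.depth_le
  have := T.depth_parent hv
  omega

theorem exists_iterate_eq_of_lt {p : V → V} {r : V} {Φ : V → ℕ}
    (h : ∀ v, v ≠ r → Φ (p v) < Φ v) (v : V) : ∃ m ≤ Φ v, p^[m] v = r := by
  induction hk : Φ v using Nat.strong_induction_on generalizing v with
  | _ k ih =>
    by_cases hv : v = r
    · exact ⟨0, Nat.zero_le _, hv⟩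
    · have hlt := h v hv
      obtain ⟨m, hm, hmv⟩ := ih _ (hk ▸ hlt) (p v) rfl
      exact ⟨m + 1, by omega, by rwa [Function.iterate_succ_apply]⟩

/-! ### Closed walks -/

theorem walkCost_singleton (T : ParentTree V) (w : V → ℝ) (a : V) : T.walkCost w [a] = 0 := by
  simp [walkCost]

theorem walkCost_cons_cons (T : ParentTree V) (w : V → ℝ) (a b : V) (l : List V) :
    T.walkCost w (a :: b :: l) = T.stepCost w a b + T.walkCost w (b :: l) := by
  simp [walkCost]

theorem ne_root_of_parent_eq {T : ParentTree V} {u v : V} (hne : u ≠ v) (h : T.parent u = v) :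
    u ≠ T.root := by
  rintro rfl
  exact hne (T.root_fix ▸ h)

theorem stepCost_up {T : ParentTree V} (w : V → ℝ) {v : V} :
    T.stepCost w v (T.parent v) = w v := by
  simp [stepCost]

theorem stepCost_down {T : ParentTree V} (w : V → ℝ) {v : V} (hv : v ≠ T.root) :
    T.stepCost w (T.parent v) v = w v := by
  unfold stepCost
  rw [if_neg]
  intro h
  exact T.not_anc_parent hv ⟨1, h⟩

/-- The weight of the path from `v` to the root. -/
noncomputable def rootDist (T : ParentTree V) (w : V → ℝ) (v : V) : ℝ :=
  if h : v = T.root then 0 else w v + T.rootDist w (T.parent v)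
termination_by T.depth v
decreasing_by have := T.depth_parent h; omega

theorem rootDist_root (T : ParentTree V) (w : V → ℝ) : T.rootDist w T.root = 0 := by
  rw [rootDist]; simp

theorem rootDist_of_ne (T : ParentTree V) (w : V → ℝ) {v : V} (hv : v ≠ T.root) :
    T.rootDist w v = w v + T.rootDist w (T.parent v) := by
  rw [rootDist]; simp [hv]

/-- A set of vertices closed under taking parents. -/
def IsClosed (T : ParentTree V) (A : Finset V) : Prop := ∀ v ∈ A, T.parent v ∈ A

theorem IsClosed.anc_mem {T : ParentTree V} {A : Finset V} (hA : T.IsClosed A) {u v : V}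
    (h : T.Anc u v) (hv : v ∈ A) : u ∈ A := by
  obtain ⟨m, rfl⟩ := h
  induction m with
  | zero => exact hv
  | succ m ih => rw [Function.iterate_succ_apply']; exact hA _ ih

theorem walk_insert_detour (T : ParentTree V) (w : V → ℝ) {v : V} (hv : v ≠ T.root)
    (a : V) (l : List V) (hc : (a :: l).IsChain T.Adj) (hp : T.parent v ∈ a :: l) :
    ∃ l', (a :: l').IsChain T.Adj ∧
      (a :: l').getLast (by simp) = (a :: l).getLast (by simp) ∧
      (∀ x, x ∈ a :: l' ↔ x = v ∨ x ∈ a :: l) ∧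
      T.walkCost w (a :: l') = T.walkCost w (a :: l) + 2 * w v := by
  have hne : v ≠ T.parent v := fun h => T.not_anc_parent hv ⟨0, h.symm⟩
  by_cases hpa : a = T.parent v
  · subst hpa
    refine ⟨v :: T.parent v :: l, ?_, by simp, ?_, ?_⟩
    · simp only [List.isChain_cons_cons]
      exact ⟨⟨hne.symm, Or.inr rfl⟩, ⟨hne, Or.inl rfl⟩, hc⟩
    · intro x
      simp only [List.mem_cons]
      tauto
    · rw [walkCost_cons_cons, walkCost_cons_cons, stepCost_up, stepCost_down w hv]
      ring
  · induction l generalizing a with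
    | nil => simp at hp; exact absurd hp.symm hpa
    | cons b l ih =>
      have hp' : T.parent v ∈ b :: l := by
        rcases List.mem_cons.1 hp with h | h
        · exact absurd h.symm hpa
        · exact h
      rw [List.isChain_cons_cons] at hc
      have key : ∃ l', (b :: l').IsChain T.Adj ∧
          (b :: l').getLast (by simp) = (b :: l).getLast (by simp) ∧
          (∀ x, x ∈ b :: l' ↔ x = v ∨ x ∈ b :: l) ∧
          T.walkCost w (b :: l') = T.walkCost w (b :: l) + 2 * w v := by
        by_cases hpb : b = T.parent v
        · subst hpb
          refine ⟨v :: T.parent v :: l, ?_, by simp, ?_, ?_⟩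
          · simp only [List.isChain_cons_cons]
            exact ⟨⟨hne.symm, Or.inr rfl⟩, ⟨hne, Or.inl rfl⟩, hc.2⟩
          · intro x
            simp only [List.mem_cons]
            tauto
          · rw [walkCost_cons_cons, walkCost_cons_cons, stepCost_up, stepCost_down w hv]
            ring
        · exact ih b hc.2 hp' hpb
      obtain ⟨l', h1, h2, h3, h4⟩ := key
      refine ⟨b :: l', List.isChain_cons_cons.2 ⟨hc.1, h1⟩, by simpa using h2, ?_, ?_⟩
      · intro x
        rw [List.mem_cons, h3, List.mem_cons (b := a)]
        tauto
      · rw [walkCost_cons_cons, h4, walkCost_cons_cons]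
        ring

theorem walk_to_root (T : ParentTree V) {w : V → ℝ} (hw : ∀ v, v ≠ T.root → 0 ≤ w v)
    (a : V) (l : List V) (hc : (a :: l).IsChain T.Adj)
    (hlast : (a :: l).getLast (by simp) = T.root) :
    T.IsClosed (a :: l).toFinset ∧
      2 * ∑ v ∈ (a :: l).toFinset.erase T.root, w v ≤
        T.walkCost w (a :: l) + T.rootDist w a := by
  induction l generalizing a with
  | nil =>
    obtain rfl : a = T.root := by simpa using hlast
    simp [IsClosed, walkCost_singleton, rootDist_root, T.root_fix]
  | cons b l ih =>
    rw [List.isChain_cons_cons] at hc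
    obtain ⟨⟨hne, hadj⟩, hc⟩ := hc
    obtain ⟨hcl, hle⟩ := ih b hc (by simpa using hlast)
    have hb : b ∈ (b :: l).toFinset := by simp
    rw [walkCost_cons_cons, List.toFinset_cons]
    rcases hadj with h | h
    · have ha := ne_root_of_parent_eq hne h
      subst h
      refine ⟨?_, ?_⟩
      · intro v hv
        rcases Finset.mem_insert.1 hv with rfl | hv
        · exact Finset.mem_insert_of_mem hb
        · exact Finset.mem_insert_of_mem (hcl v hv)
      · rw [stepCost_up, T.rootDist_of_ne w ha, Finset.erase_insert_of_ne ha]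
        have : ∑ v ∈ insert a ((T.parent a :: l).toFinset.erase T.root), w v ≤
            w a + ∑ v ∈ (T.parent a :: l).toFinset.erase T.root, w v := by
          by_cases hm : a ∈ (T.parent a :: l).toFinset.erase T.root
          · rw [Finset.insert_eq_of_mem hm]
            linarith [hw a ha]
          · rw [Finset.sum_insert hm]
        linarith
    · have hbr := ne_root_of_parent_eq hne.symm h
      subst h
      rw [Finset.insert_eq_of_mem (hcl b hb)]
      refine ⟨hcl, ?_⟩
      rw [stepCost_down w hbr]
      have := T.rootDist_of_ne w hbr
      linarith

theorem exists_walk (T : ParentTree V) (w : V → ℝ) (A : Finset V) (hA : T.IsClosed A)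
    (hr : T.root ∈ A) :
    ∃ l, (T.root :: l).IsChain T.Adj ∧ (T.root :: l).getLast (by simp) = T.root ∧
      (∀ x, x ∈ T.root :: l ↔ x ∈ A) ∧
      T.walkCost w (T.root :: l) = 2 * ∑ v ∈ A.erase T.root, w v := by
  induction h : (A.erase T.root).card generalizing A with
  | zero =>
    rw [Finset.card_eq_zero] at h
    refine ⟨[], by simp, by simp, ?_, by simp [walkCost_singleton, h]⟩
    intro x
    rw [List.mem_singleton]
    constructor
    · rintro rfl; exact hr
    · intro hx
      by_contra hne
      have : x ∈ A.erase T.root := Finset.mem_erase.2 ⟨hne, hx⟩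
      simp [h] at this
  | succ k ih =>
    obtain ⟨v, hvA, hmax⟩ := Finset.exists_max_image (A.erase T.root) T.depth
      (Finset.card_pos.1 (by omega))
    obtain ⟨hvr, hv⟩ := Finset.mem_erase.1 hvA
    have hpv : ∀ u ∈ A.erase v, T.parent u ∈ A.erase v := by
      intro u hu
      obtain ⟨huv, huA⟩ := Finset.mem_erase.1 hu
      refine Finset.mem_erase.2 ⟨?_, hA u huA⟩
      intro hpu
      by_cases hur : u = T.root
      · subst hur; exact hvr (hpu ▸ T.root_fix)
      · have h1 := hmax u (Finset.mem_erase.2 ⟨hur, huA⟩)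
        have h2 := T.depth_parent hur
        rw [hpu] at h2
        omega
    have hcomm : (A.erase v).erase T.root = (A.erase T.root).erase v := Finset.erase_right_comm
    obtain ⟨l, h1, h2, h3, h4⟩ := ih (A.erase v) hpv (Finset.mem_erase.2 ⟨hvr.symm, hr⟩)
      (by rw [hcomm, Finset.card_erase_of_mem hvA]; omega)
    have hmem : T.parent v ∈ T.root :: l := by
      rw [h3]
      refine Finset.mem_erase.2 ⟨fun h => T.not_anc_parent hvr ⟨0, h⟩, hA v hv⟩
    obtain ⟨l', g1, g2, g3, g4⟩ := T.walk_insert_detour w hvr _ l h1 hmem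
    refine ⟨l', g1, g2.trans h2, ?_, ?_⟩
    · intro x
      rw [g3, h3, Finset.mem_erase]
      by_cases hx : x = v
      · simp [hx, hv]
      · simp [hx]
    · rw [g4, h4, hcomm, ← Finset.add_sum_erase _ _ hvA]
      ring

variable [Fintype V]

theorem Tour.isClosed_walk {T : ParentTree V} {Q : ℕ} (t : T.Tour Q) :
    T.IsClosed t.walk.toFinset := by
  obtain ⟨l, p, hne, hc, hh, hl, hp, hcap⟩ := t
  cases l with
  | nil => exact absurd rfl hne
  | cons a l => exact (T.walk_to_root (w := fun _ => 0) (by simp) a l hc hl).1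

theorem Tour.sum_le_cost {T : ParentTree V} {Q : ℕ} (t : T.Tour Q) {w : V → ℝ}
    (hw : ∀ v, v ≠ T.root → 0 ≤ w v) :
    2 * ∑ v ∈ t.walk.toFinset.erase T.root, w v ≤ T.tourCost w t := by
  obtain ⟨l, p, hne, hc, hh, hl, hp, hcap⟩ := t
  cases l with
  | nil => exact absurd rfl hne
  | cons a l =>
    obtain rfl : a = T.root := by simpa using hh
    simpa [tourCost, rootDist_root] using (T.walk_to_root hw _ l hc hl).2

theorem Tour.root_mem {T : ParentTree V} {Q : ℕ} (t : T.Tour Q) : T.root ∈ t.walk.toFinset := by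
  rw [List.mem_toFinset, ← t.head_eq]
  exact List.head_mem _

theorem exists_tour (T : ParentTree V) (w : V → ℝ) {Q : ℕ} {A : Finset V} (hA : T.IsClosed A)
    (hr : T.root ∈ A) (p : V → ℕ) (hp : ∀ v, p v ≠ 0 → v ∈ A) (hQ : ∑ v, p v ≤ Q) :
    ∃ t : T.Tour Q, t.pickup = p ∧ T.tourCost w t = 2 * ∑ v ∈ A.erase T.root, w v := by
  obtain ⟨l, h1, h2, h3, h4⟩ := T.exists_walk w A hA hr
  exact ⟨⟨T.root :: l, p, by simp, h1, by simp, h2, fun v hv => (h3 v).2 (hp v hv), hQ⟩, rfl, h4⟩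

/-! ### Comparing optimal values -/

theorem opt_le_mul_opt {T T' : ParentTree V} {w w' : V → ℝ} {c : ℝ} (hc : 0 ≤ c) {Q : ℕ}
    (hw' : ∀ v, v ≠ T'.root → 0 ≤ w' v)
    (h : ∀ t : T.Tour Q, ∃ t' : T'.Tour Q, t'.pickup = t.pickup ∧
      T'.tourCost w' t' ≤ c * T.tourCost w t)
    (h' : ∀ t' : T'.Tour Q, ∃ t : T.Tour Q, t.pickup = t'.pickup) (d : V → ℕ) :
    T'.opt w' d Q ≤ c * T.opt w d Q := by
  choose f hfp hfc using h
  choose g hg using h'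
  unfold opt
  set X := {c : ℝ | ∃ S : Multiset (T.Tour Q), T.Feasible Q d S ∧ T.solCost w S = c}
  set X' := {c : ℝ | ∃ S : Multiset (T'.Tour Q), T'.Feasible Q d S ∧ T'.solCost w' S = c}
  have hbdd : BddBelow X' := by
    refine ⟨0, ?_⟩
    rintro _ ⟨S, -, rfl⟩
    refine Multiset.sum_nonneg ?_
    intro x hx
    obtain ⟨t, -, rfl⟩ := Multiset.mem_map.1 hx
    refine le_trans ?_ (t.sum_le_cost hw')
    refine mul_nonneg zero_le_two (Finset.sum_nonneg fun v hv => hw' v (Finset.mem_erase.1 hv).1)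
  rcases X.eq_empty_or_nonempty with hX | hX
  · have hX' : X' = ∅ := by
      rw [Set.eq_empty_iff_forall_notMem]
      rintro _ ⟨S, hS, rfl⟩
      have : T.solCost w (S.map g) ∈ X := by
        refine ⟨_, ?_, rfl⟩
        intro v
        simp only [Multiset.map_map, Function.comp_def, hg]
        exact hS v
      simp [hX] at this
    simp [hX, hX']
  · rw [← smul_eq_mul, ← Real.sInf_smul_of_nonneg hc]
    refine le_csInf (hX.smul_set) ?_
    rintro _ ⟨_, ⟨S, hS, rfl⟩, rfl⟩
    have hmem : T'.solCost w' (S.map f) ∈ X' := by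
      refine ⟨_, ?_, rfl⟩
      intro v
      simp only [Multiset.map_map, Function.comp_def, hfp]
      exact hS v
    refine (csInf_le hbdd hmem).trans ?_
    simp only [solCost, Multiset.map_map, Function.comp_def, smul_eq_mul]
    rw [← Multiset.sum_map_mul_left]
    exact Multiset.sum_map_le_sum_map _ _ fun t _ => hfc t

/-! ### Heavy and light vertices -/

/-- The number of descendants of `v`, including `v`. -/
noncomputable def size (T : ParentTree V) (v : V) : ℕ :=
  (Finset.univ.filter fun u => T.Anc v u).card

theorem size_pos (T : ParentTree V) (v : V) : 0 < T.size v :=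
  Finset.card_pos.2 ⟨v, by simp [Anc.refl]⟩

theorem size_lt_size_parent (T : ParentTree V) {v : V} (hv : v ≠ T.root) :
    T.size v < T.size (T.parent v) := by
  refine Finset.card_lt_card ((Finset.ssubset_iff_of_subset ?_).2 ⟨T.parent v, ?_, ?_⟩)
  · intro u
    simpa using Anc.parent_left
  · simp [Anc.refl]
  · simpa using T.not_anc_parent hv

theorem depth_add_size_le (T : ParentTree V) (v : V) : T.depth v + T.size v ≤ Fintype.card V := by
  induction v using induction (T := T) with
  | root => rw [depth_root, zero_add]; exact Finset.card_le_univ _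
  | step v hv ih =>
    have := T.depth_parent hv
    have := T.size_lt_size_parent hv
    omega

theorem size_add_size_le (T : ParentTree V) {a b : V} (ha : a ≠ T.root) (hb : b ≠ T.root)
    (hab : a ≠ b) (h : T.parent a = T.parent b) : T.size a + T.size b ≤ T.size (T.parent a) := by
  unfold size
  rw [← Finset.card_union_of_disjoint]
  · refine Finset.card_le_card ?_
    intro u hu
    simp only [Finset.mem_union, Finset.mem_filter, Finset.mem_univ, true_and] at hu ⊢
    rcases hu with hu | hu
    · exact hu.parent_left
    · exact h ▸ hu.parent_left
  · rw [Finset.disjoint_left]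
    intro u hu hu'
    simp only [Finset.mem_filter, Finset.mem_univ, true_and] at hu hu'
    rcases hu.total hu' with h' | h'
    · exact T.not_anc_parent ha (h ▸ h'.parent_of_ne hab)
    · exact T.not_anc_parent hb (h ▸ h'.parent_of_ne hab.symm)

/-- A vertex is heavy if it carries more than half of the subtree of its parent. -/
def Heavy (T : ParentTree V) (v : V) : Prop :=
  v ≠ T.root ∧ T.size (T.parent v) < 2 * T.size v

theorem Heavy.eq_of_parent_eq {T : ParentTree V} {a b : V} (ha : T.Heavy a) (hb : T.Heavy b)
    (h : T.parent a = T.parent b) : a = b := by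
  by_contra hab
  have h1 := T.size_add_size_le ha.1 hb.1 hab h
  have h2 := ha.2
  have h3 := hb.2
  rw [← h] at h3
  omega

theorem sum_sub_heavy_nonneg (T : ParentTree V) {A : Finset V} (hA : T.IsClosed A) {z : V → ℝ}
    (hz : ∀ v, 0 ≤ z v) :
    0 ≤ ∑ v ∈ A, (z v - if T.Heavy v then z (T.parent v) else 0) := by
  rw [Finset.sum_sub_distrib, ← Finset.sum_filter, sub_nonneg]
  rw [← Finset.sum_image (f := z) (g := T.parent) (s := A.filter T.Heavy)]
  · refine Finset.sum_le_sum_of_subset_of_nonneg ?_ fun v _ _ => hz v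
    intro u hu
    obtain ⟨v, hv, rfl⟩ := Finset.mem_image.1 hu
    exact hA v (Finset.mem_filter.1 hv).1
  · intro a ha b hb h
    exact (Finset.mem_filter.1 ha).2.eq_of_parent_eq (Finset.mem_filter.1 hb).2 h

/-- The number of light vertices, other than the root, on the path from `v` to the root. -/
noncomputable def lightDepth (T : ParentTree V) (v : V) : ℕ :=
  if h : v = T.root then 0 else T.lightDepth (T.parent v) + if T.Heavy v then 0 else 1
termination_by T.depth v
decreasing_by have := T.depth_parent h; omega

theorem lightDepth_root (T : ParentTree V) : T.lightDepth T.root = 0 := by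
  rw [lightDepth]; simp

theorem lightDepth_of_heavy {T : ParentTree V} {v : V} (hv : T.Heavy v) :
    T.lightDepth v = T.lightDepth (T.parent v) := by
  rw [lightDepth]; simp [hv, hv.1]

theorem lightDepth_of_not_heavy {T : ParentTree V} {v : V} (hr : v ≠ T.root) (hv : ¬ T.Heavy v) :
    T.lightDepth v = T.lightDepth (T.parent v) + 1 := by
  rw [lightDepth]; simp [hv, hr]

theorem two_pow_lightDepth_mul_size_le (T : ParentTree V) (v : V) :
    2 ^ T.lightDepth v * T.size v ≤ Fintype.card V := by
  induction v using induction (T := T) with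
  | root => rw [lightDepth_root, pow_zero, one_mul]; exact Finset.card_le_univ _
  | step v hv ih =>
    refine le_trans ?_ ih
    by_cases hh : T.Heavy v
    · rw [lightDepth_of_heavy hh]
      exact Nat.mul_le_mul_left _ (T.size_lt_size_parent hv).le
    · rw [lightDepth_of_not_heavy hv hh, pow_succ, mul_assoc]
      refine Nat.mul_le_mul_left _ ?_
      by_contra hlt
      exact hh ⟨hv, not_le.1 hlt⟩

/-- The weight of the path from `v` up to and including the edge above the first light vertex. -/
noncomputable def heavyDist (T : ParentTree V) (w : V → ℕ) (v : V) : ℕ :=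
  if h : v = T.root then 0 else w v + if T.Heavy v then T.heavyDist w (T.parent v) else 0
termination_by T.depth v
decreasing_by have := T.depth_parent h; omega

theorem heavyDist_root (T : ParentTree V) (w : V → ℕ) : T.heavyDist w T.root = 0 := by
  rw [heavyDist]; simp

theorem heavyDist_of_ne (T : ParentTree V) (w : V → ℕ) {v : V} (hv : v ≠ T.root) :
    T.heavyDist w v = w v + if T.Heavy v then T.heavyDist w (T.parent v) else 0 := by
  rw [heavyDist]; simp [hv]

theorem heavyDist_parent_le {T : ParentTree V} (w : V → ℕ) {v : V} (hv : T.Heavy v) :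
    T.heavyDist w (T.parent v) ≤ T.heavyDist w v := by
  rw [T.heavyDist_of_ne w hv.1, if_pos hv]
  omega

theorem heavyDist_le (T : ParentTree V) {w : V → ℕ} {W : ℝ} (hW : 0 ≤ W)
    (hw : ∀ v, v ≠ T.root → (w v : ℝ) ≤ W) (v : V) :
    (T.heavyDist w v : ℝ) ≤ T.depth v * W := by
  induction v using induction (T := T) with
  | root => simp [heavyDist_root, depth_root]
  | step v hv ih =>
    have h1 := hw v hv
    have h2 : (0 : ℝ) ≤ T.depth (T.parent v) * W := by positivity
    rw [heavyDist_of_ne T w hv, T.depth_parent hv]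
    push_cast
    split_ifs
    · linarith
    · linarith

/-! ### Compressing heavy paths -/

/-- For a bucketing `g` of the distances along heavy paths, `v` is a leader if it is the topmost
vertex of its heavy path in its bucket. -/
def Leader (T : ParentTree V) (w : V → ℕ) (g : ℕ → ℕ) (v : V) : Prop :=
  T.Heavy v → g (T.heavyDist w v) ≠ g (T.heavyDist w (T.parent v))

theorem not_leader_iff {T : ParentTree V} {w : V → ℕ} {g : ℕ → ℕ} {v : V} :
    ¬ T.Leader w g v ↔
      T.Heavy v ∧ g (T.heavyDist w v) = g (T.heavyDist w (T.parent v)) := by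
  simp [Leader]

/-- The topmost vertex in the heavy path and the bucket of `v`. -/
noncomputable def leader (T : ParentTree V) (w : V → ℕ) (g : ℕ → ℕ) (v : V) : V :=
  if h : T.Leader w g v then v else T.leader w g (T.parent v)
termination_by T.depth v
decreasing_by have := T.depth_parent (not_leader_iff.1 h).1.1; omega

section

variable {T : ParentTree V} {w : V → ℕ} {g : ℕ → ℕ}

theorem leader_eq_self {v : V} (h : T.Leader w g v) : T.leader w g v = v := by
  rw [leader]; simp [h]

theorem leader_eq_leader_parent {v : V} (h : ¬ T.Leader w g v) :
    T.leader w g v = T.leader w g (T.parent v) := by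
  rw [leader]; simp [h]

theorem root_isLeader : T.Leader w g T.root := fun h => absurd rfl h.1

theorem leader_spec (v : V) :
    T.Leader w g (T.leader w g v) ∧ T.Anc (T.leader w g v) v ∧
      g (T.heavyDist w (T.leader w g v)) = g (T.heavyDist w v) ∧
      T.heavyDist w (T.leader w g v) ≤ T.heavyDist w v ∧
      T.lightDepth (T.leader w g v) = T.lightDepth v := by
  induction v using induction (T := T) with
  | root =>
    rw [leader_eq_self root_isLeader]
    exact ⟨root_isLeader, Anc.refl _ _, rfl, le_rfl, rfl⟩
  | step v hv ih =>
    by_cases h : T.Leader w g v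
    · rw [leader_eq_self h]
      exact ⟨h, Anc.refl _ _, rfl, le_rfl, rfl⟩
    · obtain ⟨h1, h2⟩ := not_leader_iff.1 h
      obtain ⟨i1, i2, i3, i4, i5⟩ := ih
      rw [leader_eq_leader_parent h]
      exact ⟨i1, i2.of_parent, i3.trans h2.symm, i4.trans (heavyDist_parent_le w h1),
        i5.trans (lightDepth_of_heavy h1).symm⟩

theorem anc_leader {u : V} (hu : T.Leader w g u) (v : V) (h : T.Anc u v) :
    T.Anc u (T.leader w g v) := by
  induction v using induction (T := T) with
  | root => rwa [leader_eq_self root_isLeader]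
  | step v hv ih =>
    by_cases hl : T.Leader w g v
    · rwa [leader_eq_self hl]
    · rw [leader_eq_leader_parent hl]
      exact ih (h.parent_of_ne fun huv => hl (huv ▸ hu))

variable (T w g) in
/-- The parent map of the compressed tree. -/
noncomputable def compressParent (v : V) : V :=
  if T.Heavy v then T.leader w g (T.parent v) else T.parent v

theorem anc_compressParent (v : V) : T.Anc (T.compressParent w g v) v := by
  unfold compressParent
  split_ifs
  · exact (leader_spec _).2.1.of_parent
  · exact (Anc.refl T _).of_parent

theorem compressParent_iterate (hg : Monotone g) {G : ℕ} (hG : ∀ v, g (T.heavyDist w v) ≤ G)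
    (v : V) : ∃ m ≤ (T.lightDepth v + 1) * (G + 2), (T.compressParent w g)^[m] v = T.root := by
  let Φ : V → ℕ := fun v => T.lightDepth v * (G + 2) + g (T.heavyDist w v) +
    if T.Leader w g v then 0 else 1
  have hΦ : ∀ v, Φ v ≤ T.lightDepth v * (G + 2) + G + 1 := by
    intro v
    have := hG v
    simp only [Φ]
    split_ifs <;> omega
  have hstep : ∀ v, v ≠ T.root → Φ (T.compressParent w g v) < Φ v := by
    intro v hv
    unfold compressParent
    split_ifs with hh
    · obtain ⟨i1, i2, i3, i4, i5⟩ := leader_spec (T := T) (w := w) (g := g) (T.parent v)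
      simp only [Φ]
      rw [i5, i3, if_pos i1, lightDepth_of_heavy hh]
      have hle := hg (heavyDist_parent_le w hh)
      split_ifs with hl
      · have := hl hh
        omega
      · omega
    · have h1 := hΦ (T.parent v)
      have h2 : T.lightDepth v * (G + 2) ≤ Φ v := by simp only [Φ]; omega
      rw [lightDepth_of_not_heavy hv hh, add_mul] at h2
      omega
  obtain ⟨m, hm, hmv⟩ := exists_iterate_eq_of_lt hstep v
  refine ⟨m, hm.trans ((hΦ v).trans ?_), hmv⟩
  rw [add_mul]
  omega

variable (T w g) in
/-- The tree obtained by attaching every vertex of a heavy path to the leader of its bucket,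
and every leader to the leader of the bucket above. -/
noncomputable def compress (hg : Monotone g) : ParentTree V where
  parent := T.compressParent w g
  root := T.root
  root_fix := by simp [compressParent, Heavy, T.root_fix]
  reach v := by
    obtain ⟨m, -, hm⟩ := compressParent_iterate (T := T) (w := w) hg
      (G := Finset.univ.sup fun v => g (T.heavyDist w v))
      (fun v => Finset.le_sup (f := fun v => g (T.heavyDist w v)) (Finset.mem_univ v)) v
    exact ⟨m, hm⟩

variable (T w g) in
/-- The distance along the heavy path from its top to the leader of `v`. -/
noncomputable def leaderDist (v : V) : ℝ := T.heavyDist w (T.leader w g v)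

variable (T w g) in
/-- The edge weights of the compressed tree. -/
noncomputable def compressWeight (v : V) : ℝ :=
  T.leaderDist w g v - if T.Heavy v then T.leaderDist w g (T.parent v) else 0

theorem leaderDist_le (v : V) : T.leaderDist w g v ≤ T.heavyDist w v := by
  unfold leaderDist
  exact_mod_cast (leader_spec v).2.2.2.1

theorem compressWeight_nonneg (v : V) : 0 ≤ T.compressWeight w g v := by
  unfold compressWeight
  split_ifs with hh
  · rw [sub_nonneg]
    by_cases hl : T.Leader w g v
    · refine (leaderDist_le _).trans ?_
      rw [leaderDist, leader_eq_self hl]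
      exact_mod_cast heavyDist_parent_le w hh
    · rw [leaderDist, leaderDist, leader_eq_leader_parent hl]
  · rw [sub_zero]
    exact Nat.cast_nonneg _

theorem compressWeight_of_not_leader {v : V} (hv : ¬ T.Leader w g v) :
    T.compressWeight w g v = 0 := by
  rw [compressWeight, if_pos (not_leader_iff.1 hv).1, leaderDist, leaderDist,
    leader_eq_leader_parent hv, sub_self]

theorem compressWeight_root : T.compressWeight w g T.root = 0 := by
  rw [compressWeight, if_neg (fun h => h.1 rfl), leaderDist, leader_eq_self root_isLeader,
    heavyDist_root]
  simp

theorem weight_eq {v : V} (hv : v ≠ T.root) :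
    (w v : ℝ) = T.heavyDist w v - if T.Heavy v then (T.heavyDist w (T.parent v) : ℝ) else 0 := by
  rw [T.heavyDist_of_ne w hv]
  push_cast
  split_ifs <;> simp

theorem sum_weight_eq {A : Finset V} (hr : T.root ∈ A) :
    ∑ v ∈ A.erase T.root, (w v : ℝ) = ∑ v ∈ A, ((T.heavyDist w v : ℝ) -
      if T.Heavy v then (T.heavyDist w (T.parent v) : ℝ) else 0) := by
  rw [← Finset.add_sum_erase _ _ hr, if_neg (fun h => h.1 rfl), heavyDist_root]
  simp only [Nat.cast_zero, sub_zero, zero_add]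
  exact Finset.sum_congr rfl fun v hv => weight_eq (Finset.mem_erase.1 hv).1

theorem sum_compressWeight_le {A : Finset V} (hA : T.IsClosed A) (hr : T.root ∈ A) :
    ∑ v ∈ A.erase T.root, T.compressWeight w g v ≤ ∑ v ∈ A.erase T.root, (w v : ℝ) := by
  rw [Finset.sum_erase _ compressWeight_root, sum_weight_eq hr, ← sub_nonneg,
    ← Finset.sum_sub_distrib]
  have hz : ∀ v, 0 ≤ T.heavyDist w v - T.leaderDist w g v := fun v =>
    sub_nonneg.2 (leaderDist_le v)
  refine (T.sum_sub_heavy_nonneg hA hz).trans_eq ?_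
  refine Finset.sum_congr rfl fun v _ => ?_
  unfold compressWeight
  split_ifs <;> ring

theorem sum_weight_le {c : ℝ} (hc : ∀ a b, g a = g b → (a : ℝ) ≤ c * b) {A : Finset V}
    (hA : T.IsClosed A) (hr : T.root ∈ A) :
    ∑ v ∈ A.erase T.root, (w v : ℝ) ≤ c * ∑ v ∈ A.erase T.root, T.compressWeight w g v := by
  rw [Finset.sum_erase _ compressWeight_root, sum_weight_eq hr, ← sub_nonneg, Finset.mul_sum,
    ← Finset.sum_sub_distrib]
  have hz : ∀ v, 0 ≤ c * T.leaderDist w g v - T.heavyDist w v := fun v =>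
    sub_nonneg.2 (hc _ _ (leader_spec v).2.2.1.symm)
  refine (T.sum_sub_heavy_nonneg hA hz).trans_eq ?_
  refine Finset.sum_congr rfl fun v _ => ?_
  unfold compressWeight
  split_ifs <;> ring

theorem anc_compress {hg : Monotone g} {u : V} (hu : T.Leader w g u) (v : V) (h : T.Anc u v) :
    (T.compress w g hg).Anc u v := by
  induction hk : T.depth v using Nat.strong_induction_on generalizing v with
  | _ k ih =>
    by_cases huv : u = v
    · exact huv ▸ Anc.refl _ _
    · have hv : v ≠ T.root := by
        rintro rfl
        exact huv h.eq_root
      have hp := h.parent_of_ne huv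
      have hd := T.depth_parent hv
      refine Anc.of_parent (T := T.compress w g hg) ?_
      change (T.compress w g hg).Anc u (T.compressParent w g v)
      by_cases hh : T.Heavy v
      · rw [compressParent, if_pos hh]
        refine ih _ ?_ _ (anc_leader hu _ hp) rfl
        have := (leader_spec (T := T) (w := w) (g := g) (T.parent v)).2.1.depth_le
        omega
      · rw [compressParent, if_neg hh]
        exact ih _ (by omega) _ hp rfl

theorem exists_compress_tour (hg : Monotone g) {Q : ℕ} (t : T.Tour Q) :
    ∃ t' : (T.compress w g hg).Tour Q, t'.pickup = t.pickup ∧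
      (T.compress w g hg).tourCost (T.compressWeight w g) t' ≤
        T.tourCost (fun v => (w v : ℝ)) t := by
  have hA := t.isClosed_walk
  obtain ⟨t', h1, h2⟩ := (T.compress w g hg).exists_tour (T.compressWeight w g) (Q := Q)
    (A := t.walk.toFinset) (fun v hv => hA.anc_mem (anc_compressParent v) hv) t.root_mem t.pickup
    (fun v hv => List.mem_toFinset.2 (t.pickup_mem v hv)) t.cap
  refine ⟨t', h1, ?_⟩
  rw [h2]
  have h3 := t.sum_le_cost (w := fun v => (w v : ℝ)) (fun v _ => Nat.cast_nonneg _)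
  have h4 := sum_compressWeight_le (w := w) (g := g) hA t.root_mem
  change 2 * ∑ v ∈ t.walk.toFinset.erase T.root, T.compressWeight w g v ≤ _
  linarith

theorem exists_tour_of_compress (hg : Monotone g) {c : ℝ} (hc0 : 0 ≤ c)
    (hc : ∀ a b, g a = g b → (a : ℝ) ≤ c * b) {Q : ℕ} (t' : (T.compress w g hg).Tour Q) :
    ∃ t : T.Tour Q, t.pickup = t'.pickup ∧ T.tourCost (fun v => (w v : ℝ)) t ≤
      c * (T.compress w g hg).tourCost (T.compressWeight w g) t' := by
  set B := t'.walk.toFinset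
  have hB : (T.compress w g hg).IsClosed B := t'.isClosed_walk
  have hrB : T.root ∈ B := t'.root_mem
  let A : Finset V := Finset.univ.filter fun v => ∃ a ∈ B, T.Anc v a
  have hBA : B ⊆ A := fun v hv => by simpa [A] using ⟨v, hv, Anc.refl T v⟩
  have hA : T.IsClosed A := by
    intro v hv
    simp only [A, Finset.mem_filter, Finset.mem_univ, true_and] at hv ⊢
    obtain ⟨a, ha, hva⟩ := hv
    exact ⟨a, ha, hva.parent_left⟩
  obtain ⟨t, h1, h2⟩ := T.exists_tour (fun v => (w v : ℝ)) (Q := Q) hA (hBA hrB) t'.pickup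
    (fun v hv => hBA (List.mem_toFinset.2 (t'.pickup_mem v hv))) t'.cap
  refine ⟨t, h1, ?_⟩
  have h3 := t'.sum_le_cost (w := T.compressWeight w g) (fun v _ => compressWeight_nonneg v)
  have h4 := sum_weight_le (w := w) hc hA (hBA hrB)
  have h5 : ∑ v ∈ B.erase T.root, T.compressWeight w g v =
      ∑ v ∈ A.erase T.root, T.compressWeight w g v := by
    rw [Finset.sum_erase _ compressWeight_root, Finset.sum_erase _ compressWeight_root]
    refine Finset.sum_subset hBA ?_
    intro v hv hvB
    by_cases hl : T.Leader w g v
    · simp only [A, Finset.mem_filter, Finset.mem_univ, true_and] at hv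
      obtain ⟨a, ha, hva⟩ := hv
      exact absurd (hB.anc_mem (anc_compress hl a hva) ha) hvB
    · exact compressWeight_of_not_leader hl
  change 2 * ∑ v ∈ B.erase T.root, T.compressWeight w g v ≤ _ at h3
  rw [h2]
  have h6 := mul_le_mul_of_nonneg_left h3 hc0
  rw [h5] at h6
  linarith

end

end ParentTree

theorem Real.half_le_log_one_add {ε : ℝ} (h0 : 0 < ε) (h1 : ε ≤ 1) :
    ε / 2 ≤ Real.log (1 + ε) := by
  have h := Real.one_sub_inv_le_log_of_pos (show 0 < 1 + ε by linarith)
  refine le_trans ?_ h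
  rw [div_le_iff₀ two_pos, sub_mul, ← sub_nonneg]
  have : (1 + ε)⁻¹ * (1 + ε) = 1 := inv_mul_cancel₀ (by linarith)
  have h2 : 0 < (1 + ε)⁻¹ := by positivity
  nlinarith

/-- Geometric bucketing of the natural numbers with ratio `1 + ε`. -/
theorem exists_geometric_bucketing {ε : ℝ} (h0 : 0 < ε) (h1 : ε ≤ 1) :
    ∃ g : ℕ → ℕ, Monotone g ∧ (∀ a b, g a = g b → (a : ℝ) ≤ (1 + ε) * b) ∧
      ∀ (a : ℕ) (X : ℝ), 1 ≤ X → (a : ℝ) ≤ X → (g a : ℝ) ≤ 1 + 2 * Real.log X / ε := by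
  have hL := Real.half_le_log_one_add h0 h1
  have hL0 : 0 < Real.log (1 + ε) := by linarith
  have hlog : ∀ a : ℕ, 0 ≤ Real.log a / Real.log (1 + ε) := fun a =>
    div_nonneg (Real.log_natCast_nonneg a) hL0.le
  refine ⟨fun a => if a = 0 then 0 else 1 + ⌊Real.log a / Real.log (1 + ε)⌋₊, ?_, ?_, ?_⟩
  · intro a b hab
    dsimp only
    split_ifs with ha hb hb
    · exact le_rfl
    · omega
    · omega
    · have : (0 : ℝ) < a := by exact_mod_cast Nat.pos_of_ne_zero ha
      gcongr
  · intro a b hab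
    dsimp only at hab
    split_ifs at hab with ha hb hb
    · simp [ha, hb]
    · omega
    · omega
    · have ha' : (0 : ℝ) < a := by exact_mod_cast Nat.pos_of_ne_zero ha
      have hb' : (0 : ℝ) < b := by exact_mod_cast Nat.pos_of_ne_zero hb
      have e : ⌊Real.log a / Real.log (1 + ε)⌋₊ = ⌊Real.log b / Real.log (1 + ε)⌋₊ := by omega
      have h2 := Nat.lt_floor_add_one (Real.log a / Real.log (1 + ε))
      have h3 := Nat.floor_le (hlog b)
      rw [e] at h2
      have h4 : Real.log a / Real.log (1 + ε) < Real.log b / Real.log (1 + ε) + 1 := by linarith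
      rw [div_add_one hL0.ne', div_lt_div_iff_of_pos_right hL0, add_comm,
        ← Real.log_mul (by linarith) hb'.ne'] at h4
      exact ((Real.log_lt_log_iff ha' (by positivity)).1 h4).le
  · intro a X hX haX
    have hX0 : 0 ≤ Real.log X := Real.log_nonneg hX
    dsimp only
    split_ifs with ha
    · push_cast
      positivity
    · have ha' : (0 : ℝ) < a := by exact_mod_cast Nat.pos_of_ne_zero ha
      push_cast
      have h3 := Nat.floor_le (hlog a)
      have h4 : Real.log a / Real.log (1 + ε) ≤ 2 * Real.log X / ε := by
        rw [div_le_div_iff₀ hL0 h0]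
        have := Real.log_le_log ha' haX
        nlinarith
      linarith

/-- Height reduction: there is an absolute constant `δ > 0` such that for every `0 < ε ≤ 1`
and every rooted tree `T` on `n ≥ 2` vertices with positive integer edge weights at most
`4n³/ε²`, there is a rooted tree `T'` on the same vertex set with the same root, nonnegative
edge weights, and height at most `δ log² n / ε`, such that for every demand `d` and capacity
`Q ≥ 1`, `opt(T', d, Q) ≤ opt(T, d, Q) ≤ (1+ε) opt(T', d, Q)`. -/
theorem stmt_13 :
    ∃ δ : ℝ, 0 < δ ∧
      ∀ ε : ℝ, 0 < ε → ε ≤ 1 →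
      ∀ (V : Type) [Fintype V],
      ∀ (T : ParentTree V) (w : V → ℕ),
        2 ≤ Fintype.card V →
        (∀ v, v ≠ T.root → 1 ≤ w v ∧ (w v : ℝ) ≤ 4 * (Fintype.card V : ℝ) ^ 3 / ε ^ 2) →
        ∃ (T' : ParentTree V) (w' : V → ℝ),
          T'.root = T.root ∧ (∀ v, 0 ≤ w' v) ∧
          T'.heightLE (δ * Real.log (Fintype.card V) ^ 2 / ε) ∧
          ∀ (d : V → ℕ) (Q : ℕ), 1 ≤ Q →
            T'.opt w' d Q ≤ T.opt (fun v => (w v : ℝ)) d Q ∧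
            T.opt (fun v => (w v : ℝ)) d Q ≤ (1 + ε) * T'.opt w' d Q := by
  refine ⟨100, by norm_num, ?_⟩
  intro ε h0 h1 V _ T w hn hw
  set n := Fintype.card V
  have hn' : (2 : ℝ) ≤ n := by exact_mod_cast hn
  have hl2 := Real.log_two_gt_d9
  have hln : Real.log 2 ≤ Real.log n := Real.log_le_log two_pos hn'
  by_cases hε : ε * n ≤ 1
  · refine ⟨T, fun v => w v, rfl, fun v => Nat.cast_nonneg _, ?_, ?_⟩
    · intro v
      refine ⟨T.depth v, ?_, T.iterate_depth v⟩
      have h2 : (T.depth v : ℝ) ≤ n := by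
        exact_mod_cast (Nat.le_add_right _ _).trans (T.depth_add_size_le v)
      refine h2.trans ?_
      rw [le_div_iff₀ h0]
      nlinarith
    · intro d Q _
      refine ⟨le_rfl, ?_⟩
      refine ParentTree.opt_le_mul_opt (by linarith) (fun v _ => Nat.cast_nonneg _) ?_
        (fun t => ⟨t, rfl⟩) d
      intro t
      refine ⟨t, rfl, ?_⟩
      have h2 : 0 ≤ T.tourCost (fun v => (w v : ℝ)) t :=
        le_trans (by positivity) (t.sum_le_cost (fun v _ => Nat.cast_nonneg _))
      nlinarith
  · push Not at hε
    obtain ⟨g, hg, hgc, hgb⟩ := exists_geometric_bucketing h0 h1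
    refine ⟨T.compress w g hg, T.compressWeight w g, rfl, ParentTree.compressWeight_nonneg,
      ?_, ?_⟩
    · have hX : ∀ v, (T.heavyDist w v : ℝ) ≤ (n : ℝ) ^ 8 := by
        intro v
        have h2 := T.heavyDist_le (w := w) (W := 4 * (n : ℝ) ^ 3 / ε ^ 2) (by positivity)
          (fun v hv => (hw v hv).2) v
        have h3 : (T.depth v : ℝ) ≤ n := by
          exact_mod_cast (Nat.le_add_right _ _).trans (T.depth_add_size_le v)
        refine h2.trans ?_
        have h4 : 4 * (n : ℝ) ^ 3 / ε ^ 2 ≤ (n : ℝ) ^ 7 := by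
          rw [div_le_iff₀ (by positivity)]
          have h5 : 1 ≤ (ε * n) ^ 2 := one_le_pow₀ hε.le
          have h6 : (4 : ℝ) ≤ n ^ 2 := by nlinarith
          calc 4 * (n : ℝ) ^ 3 ≤ n ^ 2 * n ^ 3 * 1 := by rw [mul_one]; gcongr
            _ ≤ n ^ 2 * n ^ 3 * (ε * n) ^ 2 := by gcongr
            _ = n ^ 7 * ε ^ 2 := by ring
        calc (T.depth v : ℝ) * (4 * (n : ℝ) ^ 3 / ε ^ 2) ≤ n * n ^ 7 := by gcongr
          _ = (n : ℝ) ^ 8 := by ring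
      have hlogX : Real.log ((n : ℝ) ^ 8) = 8 * Real.log n := by
        rw [Real.log_pow]; norm_num
      have hgG : ∀ v, g (T.heavyDist w v) ≤ ⌊1 + 16 * Real.log n / ε⌋₊ := by
        intro v
        refine Nat.le_floor ?_
        have := hgb _ _ (one_le_pow₀ (by linarith)) (hX v)
        rw [hlogX] at this
        rwa [← mul_assoc, show (2 : ℝ) * 8 = 16 by norm_num] at this
      intro v
      obtain ⟨m, hm, hmv⟩ := ParentTree.compressParent_iterate hg hgG v
      refine ⟨m, ?_, hmv⟩
      have hlog0 : 0 < Real.log n := by linarith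
      have hG : (⌊1 + 16 * Real.log n / ε⌋₊ : ℝ) ≤ 1 + 16 * Real.log n / ε :=
        Nat.floor_le (by positivity)
      have hlight : (T.lightDepth v : ℝ) * Real.log 2 ≤ Real.log n := by
        rw [← Real.log_pow]
        refine Real.log_le_log (by positivity) ?_
        have := (Nat.le_mul_of_pos_right _ (T.size_pos v)).trans
          (T.two_pow_lightDepth_mul_size_le v)
        exact_mod_cast this
      have hlight' : (T.lightDepth v : ℝ) + 1 ≤ 3 * Real.log n := by
        have : (0 : ℝ) ≤ T.lightDepth v := Nat.cast_nonneg _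
        nlinarith
      have hG' : (⌊1 + 16 * Real.log n / ε⌋₊ : ℝ) + 2 ≤ 21 * Real.log n / ε := by
        have : 3 ≤ 5 * Real.log n / ε := by
          rw [le_div_iff₀ h0]
          nlinarith
        have e : 21 * Real.log n / ε = 16 * Real.log n / ε + 5 * Real.log n / ε := by ring
        linarith
      calc (m : ℝ) ≤ ((T.lightDepth v : ℝ) + 1) * ((⌊1 + 16 * Real.log n / ε⌋₊ : ℝ) + 2) := by
            exact_mod_cast hm
        _ ≤ (3 * Real.log n) * (21 * Real.log n / ε) := by gcongr
        _ = 63 * Real.log n ^ 2 / ε := by ring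
        _ ≤ 100 * Real.log n ^ 2 / ε := by gcongr; norm_num
    · intro d Q _
      refine ⟨?_, ?_⟩
      · rw [← one_mul (T.opt _ d Q)]
        refine ParentTree.opt_le_mul_opt zero_le_one
          (fun v _ => ParentTree.compressWeight_nonneg v) ?_ ?_ d
        · intro t
          simpa using ParentTree.exists_compress_tour hg t
        · intro t
          obtain ⟨t', ht', -⟩ := ParentTree.exists_tour_of_compress hg (by linarith) hgc t
          exact ⟨t', ht'⟩
      · refine ParentTree.opt_le_mul_opt (by linarith) (fun v _ => Nat.cast_nonneg _) ?_ ?_ d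
        · exact ParentTree.exists_tour_of_compress hg (by linarith) hgc
        · intro t
          obtain ⟨t', ht', -⟩ := ParentTree.exists_compress_tour (w := w) hg t
          exact ⟨t', ht'⟩
end
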